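/- arXiv:1511.09378 — 6 statements merged into one kernel-verified Lean document; each statement's English description precedes it below -/
import Mathlib

section
/- Every finite-above inverse monoid M is quasi-generated by its maximal elements distinct from 1: M is generated, under multiplication and inversion, by the set {m ∈ M : m is maximal and m ≠ 1} together with the set of idempotents of M. -/
namespace FInv

variable {M : Type*}

/-- The natural partial order on an inverse monoid: `a ≤ b` iff `a = e * b`
for some idempotent `e`. -/
def natLe [Monoid M] (a b : M) : Prop := ∃ e : M, e * e = e ∧ a = e * b

/-- `inv` is an inversion map making the monoid an inverse monoid:
every element has a unique generalized inverse, given by `inv`. -/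
def IsInverseMonoid [Monoid M] (inv : M → M) : Prop :=
  (∀ a : M, a * inv a * a = a) ∧ (∀ a : M, inv a * a * inv a = inv a) ∧
    (∀ a b : M, a * b * a = a → b * a * b = b → b = inv a)

/-- `m` is maximal with respect to the natural partial order. -/
def IsMaximal [Monoid M] (m : M) : Prop := ∀ n : M, natLe m n → n = m

/-- `M` is finite-above: the set of elements above any element is finite. -/
def FiniteAbove (M : Type*) [Monoid M] : Prop := ∀ m : M, {n : M | natLe m n}.Finite

/-- The least group congruence `σ`: `a σ b` iff some element lies below both. -/
def sigmaRel [Monoid M] (a b : M) : Prop := ∃ c : M, natLe c a ∧ natLe c b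

/-- `M` is E-unitary: every element above an idempotent is idempotent. -/
def EUnitary (M : Type*) [Monoid M] : Prop :=
  ∀ e a : M, e * e = e → natLe e a → a * a = a

/-- The set of idempotents of `M`. -/
def idems (M : Type*) [Monoid M] : Set M := {e : M | e * e = e}

/-- The submonoid generated by `S` together with the inverses of elements of `S`,
i.e. the closure of `S` under multiplication and inversion. -/
def invClosure [Monoid M] (inv : M → M) (S : Set M) : Submonoid M :=
  Submonoid.closure (S ∪ inv '' S)

/-- `M` is quasi-generated by `S`: `M` is generated, under multiplication and
inversion, by `S` together with the idempotents of `M`. -/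
def QuasiGen [Monoid M] (inv : M → M) (S : Set M) : Prop :=
  invClosure inv (S ∪ idems M) = ⊤

/-- A homomorphism is idempotent-separating if it is injective on idempotents. -/
def IdempotentSeparating [Monoid M] {N : Type*} [Monoid N] (φ : M →* N) : Prop :=
  ∀ e f : M, e * e = e → f * f = f → φ e = φ f → e = f

/-- A dual premorphism from a group `H` to an inverse monoid `M` (with inversion `inv`). -/
def IsDualPremorphism {H : Type*} [Group H] [Monoid M] (inv : M → M) (ψ : H → M) : Prop :=
  ψ 1 = 1 ∧ (∀ h : H, ψ h⁻¹ = inv (ψ h)) ∧ ∀ g h : H, natLe (ψ g * ψ h) (ψ (g * h))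

/-- Property (1): every element of `M` lies below some `ψ h`. -/
def Property1 {H : Type*} [Group H] [Monoid M] (ψ : H → M) : Prop :=
  ∀ m : M, ∃ h : H, natLe m (ψ h)

end FInv

open FInv

/-- In an inverse monoid products of idempotents are idempotent. -/
theorem idem_mul_idem {M : Type*} [Monoid M] (inv : M → M)
    (hM : IsInverseMonoid inv) (e f : M) (he : e * e = e) (hf : f * f = f) :
    (e * f) * (e * f) = e * f ∧ inv (e * f) = e * f := by
  obtain ⟨h1, h2, h3⟩ := hM
  have hee : ∀ z, e * (e * z) = e * z := fun z => by rw [← mul_assoc, he]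
  have hff : ∀ z, f * (f * z) = f * z := fun z => by rw [← mul_assoc, hf]
  have a1 := h1 (e * f)
  have a2 := h2 (e * f)
  set x := inv (e * f) with hx
  have a2z : ∀ z, x * (e * (f * (x * z))) = x * z := fun z => by
    conv_rhs => rw [← a2]
    simp only [mul_assoc]
  have k : f * x * e = x := by
    apply h3
    · simp only [mul_assoc, hee, hff] at a1 ⊢
      exact a1
    · simp only [mul_assoc, hee, hff, a2z]
  have xx : x * x = x := by
    calc x * x = (f * x * e) * (f * x * e) := by rw [k]
      _ = f * x * e := by simp only [mul_assoc, a2z]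
      _ = x := k
  have i1 : x = inv x := h3 x x (by rw [xx, xx]) (by rw [xx, xx])
  have i2 : e * f = inv x := h3 x (e * f) a2 a1
  have i3 : e * f = x := i2.trans i1.symm
  exact ⟨by rw [i3, xx], i3.symm⟩

/-- In an inverse monoid idempotents commute. -/
theorem idem_comm {M : Type*} [Monoid M] (inv : M → M)
    (hM : IsInverseMonoid inv) (e f : M) (he : e * e = e) (hf : f * f = f) :
    e * f = f * e := by
  obtain ⟨p, q⟩ := idem_mul_idem inv hM e f he hf
  obtain ⟨pfe, -⟩ := idem_mul_idem inv hM f e hf he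
  have hee : ∀ z, e * (e * z) = e * z := fun z => by rw [← mul_assoc, he]
  have hff : ∀ z, f * (f * z) = f * z := fun z => by rw [← mul_assoc, hf]
  rw [← q]
  symm
  apply hM.2.2
  · simp only [mul_assoc, hee, hff] at p ⊢
    exact p
  · simp only [mul_assoc, hee, hff] at pfe ⊢
    exact pfe

/-- The natural partial order as a `PartialOrder`. -/
@[reducible] def natOrder {M : Type*} [Monoid M] (inv : M → M)
    (hM : IsInverseMonoid inv) : PartialOrder M where
  le := natLe
  le_refl a := ⟨1, by simp, by simp⟩
  le_trans := by
    rintro a b c ⟨e, he, rfl⟩ ⟨f, hf, rfl⟩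
    exact ⟨e * f, (idem_mul_idem inv hM e f he hf).1, by rw [mul_assoc]⟩
  le_antisymm := by
    rintro a b ⟨e, he, h⟩ ⟨f, hf, hba⟩
    have fb : f * b = b := by rw [hba, ← mul_assoc, hf]
    calc a = e * b := h
      _ = e * (f * b) := by rw [fb]
      _ = f * (e * b) := by rw [← mul_assoc, idem_comm inv hM e f he hf, mul_assoc]
      _ = b := by rw [← h, ← hba]

/-- Every finite-above inverse monoid is quasi-generated by its maximal elements
distinct from `1`. -/
theorem stmt1 {M : Type*} [Monoid M] (inv : M → M)
    (hM : IsInverseMonoid inv) (hfa : FiniteAbove M) :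
    QuasiGen inv {m : M | IsMaximal m ∧ m ≠ 1} := by
  let _ := natOrder inv hM
  unfold QuasiGen invClosure
  rw [eq_top_iff]
  intro a _
  obtain ⟨m, ham, hm⟩ := (hfa a).exists_le_maximal (a := a) (le_refl a)
  have hmax : IsMaximal m := fun n hn =>
    le_antisymm (hm.2 (le_trans ham hn : a ≤ n) hn) hn
  obtain ⟨e, he, rfl⟩ := ham
  refine mul_mem (Submonoid.subset_closure (Or.inl (Or.inr he))) ?_
  by_cases h1 : m = 1
  · rw [h1]
    exact one_mem _
  · exact Submonoid.subset_closure (Or.inl (Or.inl ⟨hmax, h1⟩))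
end

section
/- Let M be a finite-above inverse monoid, U an E-unitary inverse monoid, and φ : U → M a surjective idempotent-separating homomorphism. Then U is finite-above, i.e., for every t ∈ U the set {y ∈ U : t ≤ y} (with respect to the natural partial order of U) is finite. -/
open FInv

theorem idem_mul_aux {U : Type*} [Monoid U] (inv : U → U) (hU : IsInverseMonoid inv)
    (e f : U) (he : e * e = e) (hf : f * f = f) : (e * f) * (e * f) = e * f := by
  obtain ⟨h1, h2, h3⟩ := hU
  have a1 := h1 (e * f)
  have a2 := h2 (e * f)
  generalize hx : inv (e * f) = x at a1 a2
  have he' : ∀ z, e * (e * z) = e * z := fun z => by rw [← mul_assoc, he]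
  have hf' : ∀ z, f * (f * z) = f * z := fun z => by rw [← mul_assoc, hf]
  simp only [mul_assoc] at a1 a2
  have a2' : ∀ z, x * (e * (f * (x * z))) = x * z := fun z => by
    have := congrArg (· * z) a2
    simpa only [mul_assoc] using this
  have b : f * x * e = x := by
    rw [← hx]
    apply h3
    · rw [hx]; simp only [mul_assoc, he', hf', a1]
    · rw [hx]; simp only [mul_assoc, he', hf', a2']
  have xx : x * x = x := by
    have : (f * x * e) * (f * x * e) = f * x * e := by
      simp only [mul_assoc, a2']
    rwa [b] at this
  have c1 : x = inv x := h3 x x (by rw [xx, xx]) (by rw [xx, xx])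
  have c2 : e * f = inv x := h3 x (e * f) (by simpa only [mul_assoc] using a2)
    (by simpa only [mul_assoc] using a1)
  rw [c2, ← c1, xx]

/-- An E-unitary cover of a finite-above inverse monoid is finite-above. -/
theorem stmt3 {M U : Type*} [Monoid M] [Monoid U]
    (invM : M → M) (invU : U → U)
    (hM : IsInverseMonoid invM) (hU : IsInverseMonoid invU)
    (hfa : FiniteAbove M) (hEU : EUnitary U)
    (φ : U →* M) (hsurj : Function.Surjective φ)
    (hsep : IdempotentSeparating φ) :
    FiniteAbove U := by
  have key : ∀ t y z : U, natLe t y → natLe t z → φ y = φ z → y = z := by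
    rintro t y z ⟨e, he, hty⟩ ⟨f, hf, htz⟩ hyz
    have hmul := idem_mul_aux invU hU
    obtain ⟨h1, h2, -⟩ := hU
    have hzz : (z * invU z) * (z * invU z) = z * invU z := by
      rw [← mul_assoc, h1]
    have hid : (y * invU z) * (y * invU z) = y * invU z := by
      refine hEU (f * (z * invU z)) _ (hmul f _ hf hzz) ⟨e, he, ?_⟩
      rw [← mul_assoc, ← mul_assoc, ← htz, ← hty]
    have e1 : y * invU z = z * invU z :=
      hsep _ _ hid hzz (by rw [map_mul, map_mul, hyz])
    have hinv : ∀ u, φ (invU u) = invM (φ u) := fun u =>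
      hM.2.2 _ _ (by rw [← map_mul, ← map_mul, h1]) (by rw [← map_mul, ← map_mul, h2])
    have e2 : invU y * y = invU z * z := by
      refine hsep _ _ ?_ ?_ ?_
      · rw [← mul_assoc, h2]
      · rw [← mul_assoc, h2]
      · rw [map_mul, map_mul, hinv, hinv, hyz]
    calc y = y * (invU y * y) := by rw [← mul_assoc, h1]
      _ = (y * invU z) * z := by rw [e2, mul_assoc]
      _ = z := by rw [e1, h1]
  intro t
  refine Set.Finite.of_finite_image (f := φ) ((hfa (φ t)).subset ?_) ?_
  · rintro _ ⟨y, ⟨e, he, hy⟩, rfl⟩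
    exact ⟨φ e, by rw [← map_mul, he], by rw [← map_mul, ← hy]⟩
  · intro y hy z hz h
    exact key t y z hy hz h
end

section
/- Let M be an inverse monoid, A a set, and ε_M : A → M an injective map whose image consists of maximal elements of M distinct from 1, such that M is quasi-A-generated with respect to ε_M. Let U be an E-unitary inverse monoid and φ : U → M a surjective idempotent-separating homomorphism. Then there exists an injective map ε_T : A → U with φ(ε_T(a)) = ε_M(a) for all a ∈ A such that, writing T for the subset of U generated under multiplication and inversion by the image of ε_T together with the set of idempotents of U: (i) φ maps T onto M; and (ii) for every a ∈ A, ε_T(a) ≠ 1 and ε_T(a) is maximal in T, i.e., no element of T is strictly above ε_T(a) in the natural partial order of U. -/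
open FInv

/-- Any E-unitary cover of a quasi-`A`-generated inverse monoid (with `A` mapped
to maximal elements distinct from `1`) contains a quasi-`A`-generated inverse
submonoid `T` covering `M`, with the generators maximal in `T` and distinct from `1`. -/
theorem stmt5 {A M U : Type*} [Monoid M] [Monoid U]
    (invM : M → M) (invU : U → U)
    (hM : IsInverseMonoid invM) (hU : IsInverseMonoid invU)
    (εM : A → M) (hinjM : Function.Injective εM)
    (hmax : ∀ a : A, IsMaximal (εM a) ∧ εM a ≠ 1)
    (hgen : QuasiGen invM (Set.range εM))
    (hEU : EUnitary U)
    (φ : U →* M) (hsurj : Function.Surjective φ)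
    (hsep : IdempotentSeparating φ) :
    ∃ εT : A → U, Function.Injective εT ∧ (∀ a : A, φ (εT a) = εM a) ∧
      (∀ m : M, ∃ y ∈ invClosure invU (Set.range εT ∪ idems U), φ y = m) ∧
      ∀ a : A, εT a ≠ 1 ∧
        ∀ y ∈ invClosure invU (Set.range εT ∪ idems U), natLe (εT a) y → y = εT a := by
  obtain ⟨hU1, hU2, hU3⟩ := hU
  obtain ⟨hM1, hM2, hM3⟩ := hM
  have hinv : ∀ u : U, φ (invU u) = invM (φ u) := fun u =>
    hM3 _ _ (by rw [← map_mul, ← map_mul, hU1]) (by rw [← map_mul, ← map_mul, hU2])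
  have hidU : ∀ u : U, (u * invU u) * (u * invU u) = u * invU u := fun u => by
    rw [← mul_assoc, hU1]
  -- any section of `φ` over the generators works
  choose s hs using hsurj
  have hT : ∀ a, φ (s (εM a)) = εM a := fun a => hs _
  refine ⟨fun a => s (εM a), fun a b h => hinjM ?_, hT, ?_, ?_⟩
  · rw [← hT a, ← hT b]
    exact congrArg φ h
  · intro m
    have hle : invClosure invM (Set.range εM ∪ idems M) ≤
        (invClosure invU (Set.range (fun a => s (εM a)) ∪ idems U)).map φ := by
      have key : ∀ x ∈ Set.range εM ∪ idems M,
          ∃ u ∈ Set.range (fun a => s (εM a)) ∪ idems U, φ u = x := by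
        rintro x (⟨a, rfl⟩ | hx)
        · exact ⟨_, Or.inl ⟨a, rfl⟩, hT a⟩
        · have hx' : x * x = x := hx
          refine ⟨s x * invU (s x), Or.inr (hidU _), ?_⟩
          rw [map_mul, hinv, hs, ← hM3 x x (by rw [hx', hx']) (by rw [hx', hx']), hx']
      refine Submonoid.closure_le.2 ?_
      rintro x (hx | ⟨x, hx, rfl⟩)
      · obtain ⟨u, hu, rfl⟩ := key x hx
        exact ⟨u, Submonoid.subset_closure (Or.inl hu), rfl⟩
      · obtain ⟨u, hu, rfl⟩ := key x hx
        exact ⟨invU u, Submonoid.subset_closure (Or.inr ⟨u, hu, rfl⟩), hinv u⟩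
    have hm : m ∈ invClosure invM (Set.range εM ∪ idems M) := by
      have hg : invClosure invM (Set.range εM ∪ idems M) = ⊤ := hgen
      rw [hg]
      trivial
    obtain ⟨y, hy, hym⟩ := hle hm
    exact ⟨y, hy, hym⟩
  · intro a
    refine ⟨fun h => (hmax a).2 ?_, ?_⟩
    · have h' : s (εM a) = 1 := h
      rw [← hT a, h', map_one]
    · rintro y - ⟨e, he, hey⟩
      have hey' : s (εM a) = e * y := hey
      have hy : φ y = εM a := (hmax a).1 _
        ⟨φ e, by rw [← map_mul, he], by rw [← map_mul, ← hey', hT]⟩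
      have hf : s (εM a) * invU (s (εM a)) = y * invU y :=
        hsep _ _ (hidU _) (hidU _) (by rw [map_mul, map_mul, hinv, hinv, hy, hT])
      have hef : e * (y * invU y) = y * invU y := by
        rw [← hf, ← mul_assoc]
        congr 1
        rw [hey', ← mul_assoc, he]
      have : e * y = y := by
        calc e * y = e * (y * invU y * y) := by rw [hU1]
          _ = e * (y * invU y) * y := by rw [mul_assoc e]
          _ = y := by rw [hef, hU1]
      exact (hey'.trans this).symm
end

section
/- Let M be a finite-above inverse monoid which is generated, under multiplication and inversion, by A ∪ E(M), where E(M) is the set of idempotents of M and A is a set of maximal elements of M distinct from 1. Then there exist a finite-above E-unitary inverse monoid U, a surjective idempotent-separating homomorphism φ : U → M, and an injective map ε_U : A → U with φ(ε_U(a)) = a for all a ∈ A, such that U is generated under multiplication and inversion by the image of ε_U together with the set of idempotents of U, and for every a ∈ A the element ε_U(a) is maximal in U and distinct from 1. -/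
open FInv

namespace FInv

/-- `U` (with inversion `invU`) is a finite-above E-unitary cover of `M` which is
quasi-generated by an injective copy `εU` of `A` consisting of maximal elements
distinct from `1`, mapped by the covering homomorphism onto `A`. -/
def IsGoodEUnitaryCover {M : Type*} [Monoid M] (A : Set M)
    (U : Type*) [Monoid U] : Prop :=
  ∃ (invU : U → U) (φ : U →* M) (εU : A → U),
    IsInverseMonoid invU ∧ FiniteAbove U ∧ EUnitary U ∧
    Function.Surjective φ ∧ IdempotentSeparating φ ∧
    Function.Injective εU ∧ (∀ a : A, φ (εU a) = (a : M)) ∧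
    QuasiGen invU (Set.range εU) ∧
    ∀ a : A, εU a ≠ 1 ∧ IsMaximal (εU a)

end FInv

namespace FInvAux

open FInv

section basics

variable {M : Type*} [Monoid M] {inv : M → M}

theorem idem_mul (hM : IsInverseMonoid inv) {e f : M} (he : e * e = e) (hf : f * f = f) :
    (e * f) * (e * f) = e * f := by
  obtain ⟨h1, h2, h3⟩ := hM
  set x := inv (e * f) with hx
  have a1 : e * f * x * (e * f) = e * f := h1 _
  have a2 : x * (e * f) * x = x := h2 _
  have hxx : f * x * e = x := by
    apply h3
    · calc e * f * (f * x * e) * (e * f) = e * (f * f) * x * ((e * e) * f) := by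
            simp only [mul_assoc]
        _ = e * f := by rw [he, hf]; exact a1
    · calc f * x * e * (e * f) * (f * x * e) = f * (x * ((e * e) * (f * f)) * x) * e := by
            simp only [mul_assoc]
        _ = f * x * e := by rw [he, hf, a2]
  have xx : x * x = x := by
    calc x * x = (f * x * e) * (f * x * e) := by rw [hxx]
      _ = f * (x * (e * f) * x) * e := by simp only [mul_assoc]
      _ = x := by rw [a2, hxx]
  have e1 : x = inv x := h3 x x (by rw [xx, xx]) (by rw [xx, xx])
  have e2 : e * f = inv x := h3 x (e * f) a2 a1
  rw [e2, ← e1, xx]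

theorem idem_inv (hM : IsInverseMonoid inv) {e : M} (he : e * e = e) : inv e = e :=
  (hM.2.2 e e (by rw [he, he]) (by rw [he, he])).symm

theorem idem_comm (hM : IsInverseMonoid inv) {e f : M} (he : e * e = e) (hf : f * f = f) :
    e * f = f * e := by
  have h1 := idem_mul hM he hf
  have h2 := idem_mul hM hf he
  have : f * e = inv (e * f) := by
    apply hM.2.2
    · calc e * f * (f * e) * (e * f) = e * (f * f) * ((e * e) * f) := by simp only [mul_assoc]
        _ = e * f := by rw [he, hf, h1]
    · calc f * e * (e * f) * (f * e) = f * (e * e) * ((f * f) * e) := by simp only [mul_assoc]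
        _ = f * e := by rw [he, hf, h2]
  rw [this, idem_inv hM h1]

theorem idem_r (hM : IsInverseMonoid inv) (a : M) : (a * inv a) * (a * inv a) = a * inv a := by
  rw [← mul_assoc, hM.1]

theorem idem_l (hM : IsInverseMonoid inv) (a : M) : (inv a * a) * (inv a * a) = inv a * a := by
  rw [← mul_assoc, hM.2.1]

theorem inv_inv' (hM : IsInverseMonoid inv) (a : M) : inv (inv a) = a :=
  (hM.2.2 _ _ (hM.2.1 a) (hM.1 a)).symm

theorem inv_mul' (hM : IsInverseMonoid inv) (a b : M) : inv (a * b) = inv b * inv a := by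
  have c := idem_comm hM (idem_l hM a) (idem_r hM b)
  symm
  apply hM.2.2
  · calc a * b * (inv b * inv a) * (a * b) = a * ((b * inv b) * (inv a * a)) * b := by
          simp only [mul_assoc]
      _ = (a * inv a * a) * (b * inv b * b) := by rw [← c]; simp only [mul_assoc]
      _ = a * b := by rw [hM.1, hM.1]
  · calc inv b * inv a * (a * b) * (inv b * inv a)
          = inv b * ((inv a * a) * (b * inv b)) * inv a := by simp only [mul_assoc]
      _ = (inv b * b * inv b) * (inv a * a * inv a) := by rw [c]; simp only [mul_assoc]
      _ = inv b * inv a := by rw [hM.2.1, hM.2.1]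

theorem conj (hM : IsInverseMonoid inv) (c : M) {e : M} (he : e * e = e) :
    ∃ f : M, f * f = f ∧ c * e = f * c := by
  have k := idem_comm hM (idem_l hM c) he
  have k2 : c * e = c * e * inv c * c := by
    calc c * e = (c * inv c * c) * e := by rw [hM.1]
      _ = c * ((inv c * c) * e) := by simp only [mul_assoc]
      _ = c * e * inv c * c := by rw [k]; simp only [mul_assoc]
  refine ⟨c * e * inv c, ?_, k2⟩
  calc c * e * inv c * (c * e * inv c) = (c * e * inv c * c) * e * inv c := by
        simp only [mul_assoc]
    _ = c * (e * e) * inv c := by rw [← k2]; simp only [mul_assoc]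
    _ = c * e * inv c := by rw [he]

theorem le_refl' (a : M) : natLe a a := ⟨1, by simp, by simp⟩

theorem le_trans' (hM : IsInverseMonoid inv) {a b c : M} (h : natLe a b) (h' : natLe b c) :
    natLe a c := by
  obtain ⟨e, he, rfl⟩ := h
  obtain ⟨f, hf, rfl⟩ := h'
  exact ⟨e * f, idem_mul hM he hf, by simp only [mul_assoc]⟩

theorem le_mul' (hM : IsInverseMonoid inv) {a b c d : M} (h : natLe a b) (h' : natLe c d) :
    natLe (a * c) (b * d) := by
  obtain ⟨e, he, rfl⟩ := h
  obtain ⟨f, hf, rfl⟩ := h'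
  obtain ⟨g, hg, k⟩ := conj hM b hf
  refine ⟨e * g, idem_mul hM he hg, ?_⟩
  calc e * b * (f * d) = e * (b * f) * d := by simp only [mul_assoc]
    _ = e * g * (b * d) := by rw [k]; simp only [mul_assoc]

theorem le_inv' (hM : IsInverseMonoid inv) {a b : M} (h : natLe a b) :
    natLe (inv a) (inv b) := by
  obtain ⟨e, he, rfl⟩ := h
  obtain ⟨g, hg, k⟩ := conj hM (inv b) he
  exact ⟨g, hg, by rw [inv_mul' hM, idem_inv hM he, k]⟩

variable {A : Set M}

/-- value of a letter -/
def letter (inv : M → M) (p : A × Bool) : M := if p.2 then (p.1 : M) else inv p.1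

/-- value of a word -/
def val (inv : M → M) (L : List (A × Bool)) : M := (L.map (letter inv)).prod

theorem val_append (L K : List (A × Bool)) : val inv (L ++ K) = val inv L * val inv K := by
  simp [val]

theorem letter_not (hM : IsInverseMonoid inv) (x : A) (b : Bool) :
    letter inv (x, !b) = inv (letter inv (x, b)) := by
  cases b <;> simp [letter, inv_inv' hM]

theorem val_step (hM : IsInverseMonoid inv) {L K : List (A × Bool)}
    (h : FreeGroup.Red.Step L K) : natLe (val inv L) (val inv K) := by
  cases h with
  | @not L₁ L₂ x b =>
    have e : val inv (L₁ ++ (x, b) :: (x, !b) :: L₂) =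
        val inv L₁ * ((letter inv (x, b) * inv (letter inv (x, b))) * val inv L₂) := by
      rw [← letter_not hM]; simp [val, mul_assoc]
    rw [e, val_append]
    exact le_mul' hM (le_refl' _) ⟨_, idem_r hM _, rfl⟩

theorem val_red (hM : IsInverseMonoid inv) {L K : List (A × Bool)}
    (h : FreeGroup.Red L K) : natLe (val inv L) (val inv K) := by
  induction h with
  | refl => exact le_refl' _
  | tail _ h ih => exact le_trans' hM ih (val_step hM h)

theorem inv_one' (hM : IsInverseMonoid inv) : inv 1 = 1 := idem_inv hM (by simp)

theorem val_invRev (hM : IsInverseMonoid inv) (L : List (A × Bool)) :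
    val inv (FreeGroup.invRev L) = inv (val inv L) := by
  induction L with
  | nil => simp [val, inv_one' hM]
  | cons p L ih =>
    obtain ⟨x, b⟩ := p
    have e1 : FreeGroup.invRev ((x, b) :: L) = FreeGroup.invRev L ++ [(x, !b)] := by
      simp [FreeGroup.invRev]
    have e2 : val inv ((x, b) :: L) = letter inv (x, b) * val inv L := by simp [val]
    have e3 : val inv [(x, !b)] = inv (letter inv (x, b)) := by
      rw [← letter_not hM]; simp [val]
    rw [e1, val_append, ih, e2, inv_mul' hM, e3]

open Classical in
/-- dual premorphism -/
noncomputable def psi (inv : M → M) (g : FreeGroup A) : M := val inv g.toWord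

theorem psi_mk (hM : IsInverseMonoid inv) (L : List (A × Bool)) :
    natLe (val inv L) (psi inv (FreeGroup.mk L)) := by
  classical
  unfold psi
  rw [FreeGroup.toWord_mk]
  exact val_red hM FreeGroup.reduce.red

theorem psi_mul (hM : IsInverseMonoid inv) (g h : FreeGroup A) :
    natLe (psi inv g * psi inv h) (psi inv (g * h)) := by
  classical
  unfold psi
  rw [← val_append, FreeGroup.toWord_mul]
  exact val_red hM FreeGroup.reduce.red

theorem psi_inv (hM : IsInverseMonoid inv) (g : FreeGroup A) :
    psi inv g⁻¹ = inv (psi inv g) := by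
  classical
  unfold psi
  rw [FreeGroup.toWord_inv, val_invRev hM]

theorem psi_one : psi inv (1 : FreeGroup A) = 1 := by
  simp [psi, val]

theorem psi_of (a : A) : psi inv (FreeGroup.of a) = a := by
  simp [psi, val, letter]

/-- the cover -/
noncomputable def cover (hM : IsInverseMonoid inv) (A : Set M) :
    Submonoid (M × FreeGroup A) where
  carrier := {p | natLe p.1 (psi inv p.2)}
  mul_mem' := by
    intro p q hp hq
    exact le_trans' hM (le_mul' hM hp hq) (psi_mul hM _ _)
  one_mem' := by
    change natLe (1 : M) (psi inv 1)
    rw [psi_one]; exact le_refl' _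

theorem mem_cover (hM : IsInverseMonoid inv) {p : M × FreeGroup A} :
    p ∈ cover hM A ↔ natLe p.1 (psi inv p.2) := Iff.rfl

/-- inversion on the cover -/
noncomputable def cinv (hM : IsInverseMonoid inv) (u : cover hM A) : cover hM A :=
  ⟨(inv u.1.1, u.1.2⁻¹), by
    rw [mem_cover]; simp only; rw [psi_inv hM]; exact le_inv' hM u.2⟩

theorem idem_snd (hM : IsInverseMonoid inv) {u : cover hM A} (h : u * u = u) :
    u.1.1 * u.1.1 = u.1.1 ∧ u.1.2 = 1 := by
  have h' := congrArg Subtype.val h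
  refine ⟨congrArg Prod.fst h', ?_⟩
  have := congrArg Prod.snd h'
  simpa using this

theorem cover_le (hM : IsInverseMonoid inv) {u v : cover hM A} (h : natLe u v) :
    natLe u.1.1 v.1.1 ∧ u.1.2 = v.1.2 := by
  obtain ⟨e, he, rfl⟩ := h
  obtain ⟨h1, h2⟩ := idem_snd hM he
  exact ⟨⟨e.1.1, h1, rfl⟩, by simp [h2]⟩

theorem le_psi (hM : IsInverseMonoid inv) (hgen : QuasiGen inv A) (m : M) :
    ∃ g : FreeGroup A, natLe m (psi inv g) := by
  have hm : m ∈ invClosure inv (A ∪ idems M) := by rw [hgen]; trivial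
  unfold invClosure at hm
  have hbase : ∀ x ∈ A ∪ idems M, ∃ g : FreeGroup A, natLe x (psi inv g) := by
    rintro x (hx | hx)
    · exact ⟨FreeGroup.of ⟨x, hx⟩, by rw [psi_of]; exact le_refl' _⟩
    · exact ⟨1, x, hx, by simp [psi_one]⟩
  induction hm using Submonoid.closure_induction with
  | mem x hx =>
    rcases hx with hx | ⟨y, hy, rfl⟩
    · exact hbase x hx
    · obtain ⟨g, hg⟩ := hbase y hy
      exact ⟨g⁻¹, by rw [psi_inv hM]; exact le_inv' hM hg⟩
  | one => exact ⟨1, by rw [psi_one]; exact le_refl' _⟩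
  | mul x y _ _ hx hy =>
    obtain ⟨g, hg⟩ := hx
    obtain ⟨h, hh⟩ := hy
    exact ⟨g * h, le_trans' hM (le_mul' hM hg hh) (psi_mul hM _ _)⟩

/-- generators of the cover -/
noncomputable def eps (hM : IsInverseMonoid inv) (a : A) : cover hM A :=
  ⟨((a : M), FreeGroup.of a), by rw [mem_cover]; simp only [psi_of]; exact le_refl' _⟩

theorem word_mem (hM : IsInverseMonoid inv) (L : List (A × Bool)) :
    ∃ u ∈ invClosure (cinv hM) (Set.range (eps hM) ∪ idems (cover hM A)),
      u.1 = (val inv L, FreeGroup.mk L) := by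
  induction L with
  | nil => exact ⟨1, one_mem _, rfl⟩
  | cons p L ih =>
    obtain ⟨u, hu, hu'⟩ := ih
    obtain ⟨x, b⟩ := p
    have key : ∃ v ∈ invClosure (cinv hM) (Set.range (eps hM) ∪ idems (cover hM A)),
        v.1 = (letter inv (x, b), FreeGroup.mk [(x, b)]) := by
      cases b with
      | true => exact ⟨eps hM x, Submonoid.subset_closure (Or.inl (Or.inl ⟨x, rfl⟩)), rfl⟩
      | false =>
        exact ⟨cinv hM (eps hM x),
          Submonoid.subset_closure (Or.inr ⟨_, Or.inl ⟨x, rfl⟩, rfl⟩), rfl⟩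
    obtain ⟨v, hv, hv'⟩ := key
    refine ⟨v * u, mul_mem hv hu, ?_⟩
    rw [Submonoid.coe_mul, hu', hv', Prod.mk_mul_mk, FreeGroup.mul_mk]
    simp [val]

end basics

end FInvAux

open FInvAux in
/-- Each quasi-`A`-generated finite-above inverse monoid with `A` consisting of
maximal elements distinct from `1` has an E-unitary cover with the same properties. -/
theorem stmt6 {M : Type u} [Monoid M] (inv : M → M)
    (hM : IsInverseMonoid inv) (hfa : FiniteAbove M)
    (A : Set M) (hAmax : ∀ a ∈ A, IsMaximal a ∧ a ≠ (1 : M))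
    (hgen : QuasiGen inv A) :
    ∃ (U : Type u) (instU : Monoid U), @IsGoodEUnitaryCover M _ A U instU := by
  refine ⟨cover hM A, inferInstance, cinv hM,
    (MonoidHom.fst M (FreeGroup A)).comp (cover hM A).subtype, eps hM,
    ⟨?_, ?_, ?_⟩, ?_, ?_, ?_, ?_, ?_, ?_, ?_, ?_⟩
  · intro u
    apply Subtype.ext
    apply Prod.ext
    · exact hM.1 _
    · simp [cinv]
  · intro u
    apply Subtype.ext
    apply Prod.ext
    · exact hM.2.1 _
    · simp [cinv]
  · intro u v h1 h2
    have h1' := congrArg Subtype.val h1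
    have h2' := congrArg Subtype.val h2
    apply Subtype.ext
    apply Prod.ext
    · exact hM.2.2 _ _ (congrArg Prod.fst h1') (congrArg Prod.fst h2')
    · have h3 : u.1.2 * v.1.2 * u.1.2 = u.1.2 := congrArg Prod.snd h1'
      have h4 : u.1.2 * v.1.2 = 1 := by simpa using h3
      exact (inv_eq_of_mul_eq_one_right h4).symm
  · intro u
    refine Set.Finite.of_finite_image (f := fun v : cover hM A => v.1.1)
      ((hfa u.1.1).subset ?_) ?_
    · rintro _ ⟨v, hv, rfl⟩
      exact (cover_le hM hv).1
    · intro v hv w hw h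
      exact Subtype.ext (Prod.ext h ((cover_le hM hv).2.symm.trans (cover_le hM hw).2))
  · intro e a he h
    have h2 := (cover_le hM h).2
    rw [(idem_snd hM he).2] at h2
    have ha : natLe a.1.1 (psi inv a.1.2) := a.2
    rw [← h2, psi_one] at ha
    obtain ⟨f, hf, hf'⟩ := ha
    rw [mul_one] at hf'
    apply Subtype.ext
    apply Prod.ext
    · change a.1.1 * a.1.1 = a.1.1
      rw [hf', hf]
    · change a.1.2 * a.1.2 = a.1.2
      rw [← h2, one_mul]
  · intro m
    obtain ⟨g, hg⟩ := le_psi hM hgen m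
    exact ⟨⟨(m, g), hg⟩, rfl⟩
  · intro e f he hf h
    exact Subtype.ext (Prod.ext h ((idem_snd hM he).2.trans (idem_snd hM hf).2.symm))
  · intro a b h
    exact Subtype.ext (congrArg (fun u : cover hM A => u.1.1) h)
  · intro a
    rfl
  · unfold QuasiGen
    rw [eq_top_iff]
    rintro u -
    classical
    obtain ⟨e, he, hu⟩ : natLe u.1.1 (psi inv u.1.2) := u.2
    obtain ⟨v, hv, hv'⟩ := word_mem hM u.1.2.toWord
    have hE : ((e, 1) : M × FreeGroup A) ∈ cover hM A := by
      rw [mem_cover]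
      exact ⟨e, he, by simp [psi_one]⟩
    have hE' : (⟨(e, 1), hE⟩ : cover hM A) ∈
        invClosure (cinv hM) (Set.range (eps hM) ∪ idems (cover hM A)) := by
      refine Submonoid.subset_closure (Or.inl (Or.inr ?_))
      exact Subtype.ext (Prod.ext he (one_mul _))
    have : u = ⟨(e, 1), hE⟩ * v := by
      apply Subtype.ext
      rw [Submonoid.coe_mul, hv', Prod.mk_mul_mk, FreeGroup.mk_toWord, one_mul]
      refine Prod.ext ?_ rfl
      rw [hu]
      unfold psi
      congr!
    rw [this]
    exact mul_mem hE' hv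
  · intro a
    refine ⟨fun h => (hAmax a a.2).2 (congrArg (fun u : cover hM A => u.1.1) h), ?_⟩
    intro n hn
    obtain ⟨h1, h2⟩ := cover_le hM hn
    exact Subtype.ext (Prod.ext ((hAmax a a.2).1 _ h1) h2.symm)
end

section
/- Let F be an F-inverse monoid, M an inverse monoid, and φ : F → M a surjective homomorphism. For x ∈ F let m_x denote the greatest element (with respect to the natural partial order) of the σ-class of x, and define ψ : F → M by ψ(x) = φ(m_x). Then: (i) if x σ y then ψ(x) = ψ(y); (ii) ψ(1) = 1; (iii) ψ(x⁻¹) = ψ(x)⁻¹ for all x; (iv) ψ(x·y) ≥ ψ(x)·ψ(y) for all x, y; and (v) for every m ∈ M there exists x ∈ F with m ≤ ψ(x). (Thus ψ induces a dual premorphism from F/σ to M with property (1), the dual premorphism induced by φ.) -/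
open FInv

section Helpers
variable {S : Type*} [Monoid S] {inv : S → S}

theorem hp_idem_mul (h : IsInverseMonoid inv) {e f : S} (he : e * e = e) (hf : f * f = f) :
    (e * f) * (e * f) = e * f := by
  obtain ⟨h1, h2, h3⟩ := h
  have he' : ∀ z, e * (e * z) = e * z := fun z => by rw [← mul_assoc, he]
  have hf' : ∀ z, f * (f * z) = f * z := fun z => by rw [← mul_assoc, hf]
  have k1 := h1 (e * f)
  have k2 := h2 (e * f)
  have k3 := h3 (e * f) (f * inv (e * f) * e)
  generalize inv (e * f) = x at k1 k2 k3
  have k2' : x * (e * (f * (x * e))) = x * e := by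
    have := congrArg (· * e) k2
    simpa only [mul_assoc] using this
  have k4 : f * x * e = x := by
    apply k3
    · simp only [mul_assoc, he', hf'] at k1 ⊢; exact k1
    · simp only [mul_assoc, he', hf', k2']
  have k6 : x * x = x := by
    conv_lhs => rw [← k4]
    conv_rhs => rw [← k4]
    simp only [mul_assoc, k2']
  have k7 := h3 x x (by rw [k6, k6]) (by rw [k6, k6])
  have k8 := h3 x (e * f) k2 k1
  rw [k8, ← k7, k6]

theorem hp_comm (h : IsInverseMonoid inv) {e f : S} (he : e * e = e) (hf : f * f = f) :
    e * f = f * e := by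
  have a1 := hp_idem_mul h he hf
  have a2 := hp_idem_mul h hf he
  obtain ⟨h1, h2, h3⟩ := h
  have he' : ∀ z, e * (e * z) = e * z := fun z => by rw [← mul_assoc, he]
  have hf' : ∀ z, f * (f * z) = f * z := fun z => by rw [← mul_assoc, hf]
  have b1 := h3 (e * f) (f * e) (by simp only [mul_assoc, he', hf'] at a1 ⊢; exact a1)
    (by simp only [mul_assoc, he', hf'] at a2 ⊢; exact a2)
  have b2 := h3 (e * f) (e * f) (by rw [a1, a1]) (by rw [a1, a1])
  rw [b1, ← b2]

theorem hp_inv_inv (h : IsInverseMonoid inv) (a : S) : inv (inv a) = a :=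
  (h.2.2 (inv a) a (h.2.1 a) (h.1 a)).symm

theorem hp_idem_left (h : IsInverseMonoid inv) (a : S) :
    (a * inv a) * (a * inv a) = a * inv a := by
  rw [← mul_assoc, h.1]

theorem hp_idem_right (h : IsInverseMonoid inv) (a : S) :
    (inv a * a) * (inv a * a) = inv a * a := by
  rw [← mul_assoc, h.2.1]

theorem hp_swap (h : IsInverseMonoid inv) (a : S) {e : S} (he : e * e = e) :
    (a * e * inv a) * (a * e * inv a) = a * e * inv a ∧ a * e = (a * e * inv a) * a := by
  have c := hp_comm h he (hp_idem_right h a)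
  have k : a * e = (a * e * inv a) * a := by
    calc a * e = (a * inv a * a) * e := by rw [h.1]
      _ = a * ((inv a * a) * e) := by simp only [mul_assoc]
      _ = _ := by rw [← c]; simp only [mul_assoc]
  refine ⟨?_, k⟩
  calc (a * e * inv a) * (a * e * inv a) = ((a * e * inv a) * a) * e * inv a := by
        simp only [mul_assoc]
    _ = a * (e * e) * inv a := by rw [← k]; simp only [mul_assoc]
    _ = _ := by rw [he]

theorem hp_refl (a : S) : natLe a a := ⟨1, by simp, by simp⟩

theorem hp_trans (h : IsInverseMonoid inv) {a b c : S} (h1 : natLe a b) (h2 : natLe b c) :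
    natLe a c := by
  obtain ⟨e, he, rfl⟩ := h1
  obtain ⟨f, hf, rfl⟩ := h2
  exact ⟨e * f, hp_idem_mul h he hf, by rw [mul_assoc]⟩

theorem hp_antisymm (h : IsInverseMonoid inv) {a b : S} (h1 : natLe a b) (h2 : natLe b a) :
    a = b := by
  obtain ⟨e, he, h1⟩ := h1
  obtain ⟨f, hf, h2⟩ := h2
  have ea : e * a = a := by rw [h1, ← mul_assoc, he]
  calc a = e * (f * a) := by rw [← h2, ← h1]
    _ = f * (e * a) := by rw [← mul_assoc, hp_comm h he hf, mul_assoc]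
    _ = b := by rw [ea, ← h2]

theorem hp_mul (h : IsInverseMonoid inv) {a b c d : S} (h1 : natLe a b) (h2 : natLe c d) :
    natLe (a * c) (b * d) := by
  obtain ⟨e, he, rfl⟩ := h1
  obtain ⟨f, hf, rfl⟩ := h2
  obtain ⟨k1, k2⟩ := hp_swap h b hf
  refine ⟨e * (b * f * inv b), hp_idem_mul h he k1, ?_⟩
  calc e * b * (f * d) = e * (b * f) * d := by simp only [mul_assoc]
    _ = _ := by rw [k2]; simp only [mul_assoc]; simp only [← mul_assoc, ← k2]

theorem hp_inv (h : IsInverseMonoid inv) {a b : S} (h1 : natLe a b) :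
    natLe (inv a) (inv b) := by
  obtain ⟨e, he, rfl⟩ := h1
  have c := hp_comm h he (hp_idem_left h b)
  have he' : ∀ z, e * (e * z) = e * z := fun z => by rw [← mul_assoc, he]
  obtain ⟨k1, k2⟩ := hp_swap h (inv b) he
  have k : inv b * e = inv (e * b) := by
    apply h.2.2
    · calc e * b * (inv b * e) * (e * b) = e * ((b * inv b) * (e * e)) * b := by
            simp only [mul_assoc]
        _ = (e * e) * (b * inv b * b) := by rw [he, ← c]; simp only [mul_assoc, he']
        _ = _ := by rw [he, h.1]
    · calc inv b * e * (e * b) * (inv b * e) = inv b * ((e * e) * (b * inv b)) * e := by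
            simp only [mul_assoc]
        _ = (inv b * b * inv b) * (e * e) := by rw [he, c]; simp only [mul_assoc, he]
        _ = _ := by rw [he, h.2.1]
  rw [← k]
  exact ⟨_, k1, k2⟩

theorem hs_symm {a b : S} (h1 : sigmaRel a b) : sigmaRel b a := by
  obtain ⟨c, x, y⟩ := h1
  exact ⟨c, y, x⟩

theorem hs_trans (h : IsInverseMonoid inv) {a b c : S} (h1 : sigmaRel a b) (h2 : sigmaRel b c) :
    sigmaRel a c := by
  obtain ⟨p, pa, e, he, pb⟩ := h1
  obtain ⟨q, ⟨f, hf, qb⟩, qc⟩ := h2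
  refine ⟨e * f * b, hp_trans h ⟨f, hf, ?_⟩ pa, hp_trans h ⟨e, he, ?_⟩ qc⟩
  · rw [pb, hp_comm h he hf, mul_assoc]
  · rw [qb, mul_assoc]

theorem hs_mul (h : IsInverseMonoid inv) {a b c d : S} (h1 : sigmaRel a b) (h2 : sigmaRel c d) :
    sigmaRel (a * c) (b * d) := by
  obtain ⟨p, pa, pb⟩ := h1
  obtain ⟨q, qc, qd⟩ := h2
  exact ⟨p * q, hp_mul h pa qc, hp_mul h pb qd⟩

theorem hs_inv (h : IsInverseMonoid inv) {a b : S} (h1 : sigmaRel a b) :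
    sigmaRel (inv a) (inv b) := by
  obtain ⟨p, pa, pb⟩ := h1
  exact ⟨inv p, hp_inv h pa, hp_inv h pb⟩

theorem hp_map {T : Type*} [Monoid T] (φ : S →* T) {a b : S} (h1 : natLe a b) :
    natLe (φ a) (φ b) := by
  obtain ⟨e, he, rfl⟩ := h1
  exact ⟨φ e, by rw [← map_mul, he], by rw [map_mul]⟩

end Helpers

/-- The dual premorphism induced by a surjective homomorphism from an F-inverse
monoid: `ψ x = φ (m_x)`, where `m_x` is the greatest element of the σ-class of `x`. -/
theorem stmt8 {F M : Type*} [Monoid F] [Monoid M]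
    (invF : F → F) (invM : M → M)
    (hF : IsInverseMonoid invF) (hM : IsInverseMonoid invM)
    (φ : F →* M) (hsurj : Function.Surjective φ)
    (mx : F → F)
    (hmx : ∀ x : F, sigmaRel x (mx x) ∧ ∀ y : F, sigmaRel x y → natLe y (mx x)) :
    (∀ x y : F, sigmaRel x y → φ (mx x) = φ (mx y)) ∧
    φ (mx 1) = 1 ∧
    (∀ x : F, φ (mx (invF x)) = invM (φ (mx x))) ∧
    (∀ x y : F, natLe (φ (mx x) * φ (mx y)) (φ (mx (x * y)))) ∧
    (∀ m : M, ∃ x : F, natLe m (φ (mx x))) := by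
  have hle : ∀ x, natLe x (mx x) := fun x => (hmx x).2 x ⟨x, hp_refl x, hp_refl x⟩
  have key : ∀ x y, sigmaRel x y → natLe (mx x) (mx y) := fun x y hxy =>
    (hmx y).2 _ (hs_trans hF (hs_symm hxy) (hmx x).1)
  refine ⟨fun x y hxy => ?_, ?_, fun x => ?_, fun x y => ?_, fun m => ?_⟩
  · rw [hp_antisymm hF (key x y hxy) (key y x (hs_symm hxy))]
  · obtain ⟨e, he, h1⟩ := hle 1
    have h2 : e = 1 := by
      calc e = e * (e * mx 1) := by rw [← h1, mul_one]
        _ = e * mx 1 := by rw [← mul_assoc, he]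
        _ = 1 := h1.symm
    rw [h2, one_mul] at h1
    rw [← h1, map_one]
  · have h1 : natLe (invF (mx x)) (mx (invF x)) := (hmx _).2 _ (hs_inv hF (hmx x).1)
    have h2 : natLe (invF (mx (invF x))) (mx x) := by
      apply (hmx x).2
      have := hs_inv hF (hmx (invF x)).1
      rwa [hp_inv_inv hF] at this
    have h3 := hp_inv hF h2
    rw [hp_inv_inv hF] at h3
    rw [hp_antisymm hF h3 h1]
    apply hM.2.2
    · rw [← map_mul, ← map_mul, hF.1]
    · rw [← map_mul, ← map_mul, hF.2.1]
  · rw [← map_mul]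
    exact hp_map φ ((hmx _).2 _ (hs_mul hF (hmx x).1 (hmx y).1))
  · obtain ⟨x, rfl⟩ := hsurj m
    exact ⟨x, hp_map φ (hle x)⟩
end

section
/- Let M be a finite-above E-unitary inverse monoid such that σ has at most two classes, i.e., for all x, y, z ∈ M at least one of x σ y, x σ z, y σ z holds. Then for every prime p there exist a group H and a dual premorphism ψ : H → M with property (1) such that the set N = {h ∈ H : ψ(h) is idempotent} satisfies n^p = 1 for every n ∈ N and any two elements of N commute. (That is, M has an F-inverse cover via an elementary Abelian p-group for any prime p.) -/
open FInv

namespace FInv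

/-- There is a dual premorphism `ψ : H → M` with property (1) whose "kernel"
`{n : H | ψ n is idempotent}` is commutative of exponent `p`. -/
def ElemAbelianKernelCover (M : Type*) [Monoid M] (invM : M → M) (p : ℕ)
    (H : Type*) [Group H] : Prop :=
  ∃ ψ : H → M, IsDualPremorphism invM ψ ∧ Property1 ψ ∧
    (∀ n : H, ψ n * ψ n = ψ n → n ^ p = 1) ∧
    (∀ n k : H, ψ n * ψ n = ψ n → ψ k * ψ k = ψ k → n * k = k * n)

end FInv


namespace FInv
section aux
variable {M : Type*} [Monoid M] {inv : M → M}

theorem idem_inv (hM : IsInverseMonoid inv) {e : M} (he : e * e = e) : inv e = e :=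
  (hM.2.2 e e (by rw [he, he]) (by rw [he, he])).symm

theorem inv_inv' (hM : IsInverseMonoid inv) (a : M) : inv (inv a) = a :=
  (hM.2.2 (inv a) a (hM.2.1 a) (hM.1 a)).symm

theorem idem_mul (hM : IsInverseMonoid inv) {e f : M} (he : e * e = e) (hf : f * f = f) :
    (e * f) * (e * f) = e * f := by
  have h1 := hM.1 (e * f)
  have h2 := hM.2.1 (e * f)
  set x := inv (e * f) with hx
  have h3 : f * x * e = x := by
    apply hM.2.2
    · calc e * f * (f * x * e) * (e * f) = e * (f * f) * x * (e * e) * f := by simp only [mul_assoc]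
        _ = e * f * x * (e * f) := by rw [he, hf]; simp only [mul_assoc]
        _ = e * f := h1
    · calc f * x * e * (e * f) * (f * x * e) = f * (x * ((e * e) * (f * f)) * x) * e := by
            simp only [mul_assoc]
        _ = f * x * e := by rw [he, hf, h2]
  have h4 : x * x = x := by
    calc x * x = (f * x * e) * (f * x * e) := by rw [h3]
      _ = f * (x * (e * f) * x) * e := by simp only [mul_assoc]
      _ = x := by rw [h2, h3]
  have h5 : e * f = x := by
    rw [← idem_inv hM h4, hx, inv_inv' hM]
  rw [h5, h4]

theorem idem_comm (hM : IsInverseMonoid inv) {e f : M} (he : e * e = e) (hf : f * f = f) :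
    e * f = f * e := by
  have h1 := idem_mul hM he hf
  have h2 := idem_mul hM hf he
  rw [← idem_inv hM h1]
  symm
  apply hM.2.2
  · calc e * f * (f * e) * (e * f) = e * (f * f) * (e * e) * f := by simp only [mul_assoc]
      _ = e * f * (e * f) := by rw [he, hf]; simp only [mul_assoc]
      _ = e * f := h1
  · calc f * e * (e * f) * (f * e) = f * (e * e) * (f * f) * e := by simp only [mul_assoc]
      _ = f * e * (f * e) := by rw [he, hf]; simp only [mul_assoc]
      _ = f * e := h2

theorem d_idem (hM : IsInverseMonoid inv) (a : M) : (a * inv a) * (a * inv a) = a * inv a := by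
  rw [← mul_assoc, hM.1]

theorem r_idem (hM : IsInverseMonoid inv) (a : M) : (inv a * a) * (inv a * a) = inv a * a := by
  rw [← mul_assoc, hM.2.1]

theorem inv_mul' (hM : IsInverseMonoid inv) (a b : M) : inv (a * b) = inv b * inv a := by
  symm
  have hc := idem_comm hM (d_idem hM b) (r_idem hM a)
  apply hM.2.2
  · calc a * b * (inv b * inv a) * (a * b) = a * ((b * inv b) * (inv a * a)) * b := by
          simp only [mul_assoc]
      _ = (a * inv a * a) * (b * inv b * b) := by rw [hc]; simp only [mul_assoc]
      _ = a * b := by rw [hM.1, hM.1]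
  · calc inv b * inv a * (a * b) * (inv b * inv a) = inv b * ((inv a * a) * (b * inv b)) * inv a := by
          simp only [mul_assoc]
      _ = (inv b * b * inv b) * (inv a * a * inv a) := by rw [← hc]; simp only [mul_assoc]
      _ = inv b * inv a := by rw [hM.2.1, hM.2.1]

theorem conj_idem (hM : IsInverseMonoid inv) (a : M) {e : M} (he : e * e = e) :
    (a * e * inv a) * (a * e * inv a) = a * e * inv a := by
  calc (a * e * inv a) * (a * e * inv a) = a * (e * (inv a * a)) * e * inv a := by
        simp only [mul_assoc]
    _ = (a * inv a * a) * (e * e) * inv a := by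
        rw [idem_comm hM he (r_idem hM a)]; simp only [mul_assoc]
    _ = a * e * inv a := by rw [hM.1, he]

/-- products of two non-idempotents are idempotent -/
theorem prod_idem (hM : IsInverseMonoid inv) (hEU : EUnitary M)
    (h2 : ∀ x y z : M, sigmaRel x y ∨ sigmaRel x z ∨ sigmaRel y z)
    {s t : M} (hs : s * s ≠ s) (ht : t * t ≠ t) : (s * t) * (s * t) = s * t := by
  have key : ∀ a : M, sigmaRel 1 a → a * a = a := by
    rintro a ⟨c, ⟨e, he, hc⟩, hca⟩
    rw [mul_one] at hc
    exact hEU c a (by rw [hc, he]) hca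
  rcases h2 1 s (s * t) with h | h | ⟨c, ⟨e, he, h1⟩, ⟨f, hf, h3⟩⟩
  · exact absurd (key _ h) hs
  · exact key _ h
  · exfalso
    apply ht
    have ci := conj_idem hM (inv s) he
    have cj := conj_idem hM (inv s) hf
    rw [inv_inv' hM] at ci cj
    refine hEU _ t ci ⟨_, cj, ?_⟩
    rw [mul_assoc, ← h1, h3]; simp only [mul_assoc]

theorem inv_nonidem (hM : IsInverseMonoid inv) {s : M} (hs : s * s ≠ s) :
    inv s * inv s ≠ inv s := by
  intro h
  apply hs
  have := idem_inv hM h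
  rw [inv_inv' hM] at this
  rw [this, h]

theorem d_conj (hM : IsInverseMonoid inv) (hEU : EUnitary M)
    (h2 : ∀ x y z : M, sigmaRel x y ∨ sigmaRel x z ∨ sigmaRel y z)
    {s u : M} (hs : s * s ≠ s) (hu : u * u ≠ u) :
    (s * (u * inv u) * inv s) * (inv u * u) = s * (u * inv u) * inv s := by
  have h := prod_idem hM hEU h2 hs hu
  have hi := idem_inv hM h
  have e1 : s * (u * inv u) * inv s = s * u := by
    calc s * (u * inv u) * inv s = (s * u) * (inv u * inv s) := by simp only [mul_assoc]
      _ = s * u := by rw [← inv_mul' hM, hi, h]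
  rw [e1, mul_assoc, ← mul_assoc u, hM.1]

theorem same (hM : IsInverseMonoid inv) (hEU : EUnitary M)
    (h2 : ∀ x y z : M, sigmaRel x y ∨ sigmaRel x z ∨ sigmaRel y z)
    {s t e : M} (hs : s * s ≠ s) (ht : t * t ≠ t)
    (h1 : e * (s * inv s) = e) (h3 : e * (t * inv t) = e) : e * s = e * t := by
  have hj := prod_idem hM hEU h2 (inv_nonidem hM hs) ht
  have hji : inv t * s = inv s * t := by
    rw [← idem_inv hM hj, inv_mul' hM, inv_inv' hM]
  have a1 : e * t = e * s * (inv s * t) := by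
    conv_lhs => rw [← h1]
    simp only [mul_assoc]
  have a2 : e * s = e * t * (inv s * t) := by
    conv_lhs => rw [← h3]
    rw [← hji]; simp only [mul_assoc]
  rw [a2]
  conv_rhs => rw [a1]
  conv_lhs => rw [a1, mul_assoc, hj]

/-- finite meets -/
theorem exists_meet (hM : IsInverseMonoid inv) {ι : Type*} (d : ι → M) (hd : ∀ i, d i * d i = d i)
    (T : Finset ι) : ∃ E : M, E * E = E ∧ (∀ s ∈ T, E * d s = E) ∧
      ∀ e : M, (∀ s ∈ T, e * d s = e) → e * E = e := by
  classical
  induction T using Finset.induction_on with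
  | empty => exact ⟨1, by simp, by simp, by simp⟩
  | insert a T _ ih =>
    obtain ⟨E, h1, h2, h3⟩ := ih
    refine ⟨E * d a, idem_mul hM h1 (hd a), ?_, ?_⟩
    · intro s hs
      rcases Finset.mem_insert.1 hs with rfl | hs
      · rw [mul_assoc, hd]
      · rw [mul_assoc, idem_comm hM (hd a) (hd s), ← mul_assoc, h2 s hs]
    · intro e he
      rw [← mul_assoc, h3 e fun s hs => he s (Finset.mem_insert_of_mem hs),
        he a (Finset.mem_insert_self _ _)]

end aux

section grp
variable {V K : Type*} [AddCommGroup V] [AddCommGroup K]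

/-- carrier of the covering group -/
def Cov (deg : V →+ K) (k : K) : Type _ := {x : V × Bool // deg x.1 = if x.2 then k else 0}

/-- multiplication on the carrier -/
def covMul (deg : V →+ K) (k : K) (τ : V →+ V)
    (hd : ∀ v, deg (τ v) = - deg v) (x y : Cov deg k) : Cov deg k :=
  ⟨(x.1.1 + (if x.1.2 then τ y.1.1 else y.1.1), xor x.1.2 y.1.2), by
      obtain ⟨⟨f, b⟩, hx⟩ := x
      obtain ⟨⟨g, c⟩, hy⟩ := y
      cases b <;> cases c <;> simp_all⟩

/-- inversion on the carrier -/
def covInv (deg : V →+ K) (k : K) (τ : V →+ V)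
    (hd : ∀ v, deg (τ v) = - deg v) (x : Cov deg k) : Cov deg k :=
  ⟨(if x.1.2 then - τ x.1.1 else - x.1.1, x.1.2), by
      obtain ⟨⟨f, b⟩, hx⟩ := x
      cases b <;> simp_all⟩

/-- the unit of the carrier -/
def covOne (deg : V →+ K) (k : K) : Cov deg k := ⟨(0, false), by simp⟩

/-- the group structure on the carrier -/
@[reducible] def covGroup (deg : V →+ K) (k : K) (τ : V →+ V) (hτ : ∀ v, τ (τ v) = v)
    (hd : ∀ v, deg (τ v) = - deg v) : Group (Cov deg k) :=
  letI : Mul (Cov deg k) := ⟨covMul deg k τ hd⟩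
  letI : Inv (Cov deg k) := ⟨covInv deg k τ hd⟩
  letI : One (Cov deg k) := ⟨covOne deg k⟩
  Group.ofLeftAxioms
    (by
      rintro ⟨⟨f, b⟩, hx⟩ ⟨⟨g, c⟩, hy⟩ ⟨⟨h, d⟩, hz⟩
      change covMul deg k τ hd (covMul deg k τ hd _ _) _
        = covMul deg k τ hd _ (covMul deg k τ hd _ _)
      apply Subtype.ext
      cases b <;> cases c <;> cases d <;> simp [covMul, hτ, add_assoc])
    (by
      rintro ⟨⟨f, b⟩, hx⟩
      change covMul deg k τ hd (covOne deg k) _ = _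
      apply Subtype.ext
      simp [covMul, covOne])
    (by
      rintro ⟨⟨f, b⟩, hx⟩
      change covMul deg k τ hd (covInv deg k τ hd _) _ = covOne deg k
      apply Subtype.ext
      cases b <;> simp [covMul, covOne, covInv])

end grp
end FInv

/-- A finite-above E-unitary inverse monoid whose least group congruence has at
most two classes has an F-inverse cover via an elementary Abelian `p`-group, for
every prime `p`. -/
theorem stmt12 {M : Type u} [Monoid M] (inv : M → M)
    (hM : IsInverseMonoid inv) (hfa : FiniteAbove M) (hEU : EUnitary M)
    (h2 : ∀ x y z : M, sigmaRel x y ∨ sigmaRel x z ∨ sigmaRel y z)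
    (p : ℕ) (hp : p.Prime) :
    ∃ (H : Type u) (instH : Group H), @ElemAbelianKernelCover M _ inv p H instH := by
  classical
  let S := {s : M // s * s ≠ s}
  let θ : S → S := fun s => ⟨inv s.1, inv_nonidem hM s.2⟩
  have hθ : Function.Involutive θ := fun s => Subtype.ext (inv_inv' hM s.1)
  let V := S →₀ ZMod p
  let deg : V →+ ZMod p := Finsupp.liftAddHom (fun _ => AddMonoidHom.id _)
  let τ : V →+ V := -(Finsupp.mapDomain.addMonoidHom θ : (S →₀ ZMod p) →+ (S →₀ ZMod p))
  have τapp : ∀ f : V, τ f = - Finsupp.mapDomain θ f := fun f => rfl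
  have hτ : ∀ f, τ (τ f) = f := by
    intro f
    rw [τapp f, map_neg, τapp, neg_neg, ← Finsupp.mapDomain_comp, hθ.comp_self,
      Finsupp.mapDomain_id]
  have hd : ∀ f, deg (τ f) = - deg f := by
    intro f
    rw [τapp, map_neg]
    congr 1
    change (Finsupp.mapDomain θ f).sum (fun _ x => x) = f.sum (fun _ x => x)
    rw [Finsupp.sum_mapDomain_index] <;> simp
  have hsupp : ∀ (f : V) (s : S), s ∈ (τ f).support ↔ θ s ∈ f.support := by
    intro f s
    rw [τapp, Finsupp.support_neg, Finsupp.mem_support_iff, Finsupp.mem_support_iff]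
    conv_lhs => rw [← hθ s, Finsupp.mapDomain_apply hθ.injective]
  have hsub : ∀ (f g : V) (s : S), s ∈ (f + g).support → s ∈ f.support ∨ s ∈ g.support :=
    fun f g s hs => Finset.mem_union.1 (Finsupp.support_add hs)
  choose E Eid Ele Egl using
    exists_meet (ι := S) hM (fun s => s.1 * inv s.1) (fun s => d_idem hM s.1)
  have hne : ∀ f : V, deg f = 1 → ∃ s, s ∈ f.support := by
    intro f hf
    by_contra hcon
    push Not at hcon
    have hf0 : f = 0 := Finsupp.support_eq_empty.1 (Finset.eq_empty_of_forall_notMem hcon)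
    have : Fact p.Prime := ⟨hp⟩
    rw [hf0, map_zero] at hf
    exact zero_ne_one hf
  have hsame : ∀ (s t : S) (e : M), e * (s.1 * inv s.1) = e → e * (t.1 * inv t.1) = e →
      e * s.1 = e * t.1 := fun s t e => same hM hEU h2 s.2 t.2
  -- conjugation of meets
  have hconj1 : ∀ (f : V) (s : S) (t : S), θ t ∈ f.support →
      (s.1 * E f.support * inv s.1) * (t.1 * inv t.1) = s.1 * E f.support * inv s.1 := by
    intro f s t ht
    have h1 := Ele f.support _ ht
    have h3 := d_conj hM hEU h2 s.2 (θ t).2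
    simp only [θ, inv_inv' hM] at h1 h3
    have hq := idem_comm hM (Eid f.support) (d_idem hM (inv t.1))
    rw [inv_inv' hM] at hq
    have hr : s.1 * E f.support * inv s.1
        = (s.1 * E f.support * inv s.1) * (s.1 * (inv t.1 * t.1) * inv s.1) := by
      calc s.1 * E f.support * inv s.1
          = s.1 * (E f.support * (inv t.1 * t.1)) * inv s.1 := by rw [h1]
        _ = (s.1 * inv s.1 * s.1) * E f.support * (inv t.1 * t.1) * inv s.1 := by
            rw [hM.1]; simp only [mul_assoc]
        _ = s.1 * ((inv s.1 * s.1) * E f.support) * (inv t.1 * t.1) * inv s.1 := by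
            simp only [mul_assoc]
        _ = s.1 * (E f.support * (inv s.1 * s.1)) * (inv t.1 * t.1) * inv s.1 := by
            rw [idem_comm hM (r_idem hM s.1) (Eid f.support)]
        _ = _ := by simp only [mul_assoc]
    rw [hr, mul_assoc, h3]
  have hconj : ∀ (f : V) (s : S),
      (s.1 * E f.support * inv s.1) * E (τ f).support = s.1 * E f.support * inv s.1 := by
    intro f s
    apply Egl
    intro t ht
    exact hconj1 f s t ((hsupp f t).1 ht)
  have hswap : ∀ (s : M) (e : M), e * e = e → s * e = s * e * inv s * s := by
    intro s e he
    rw [mul_assoc (s * e), mul_assoc s, idem_comm hM he (r_idem hM s), ← mul_assoc, ← mul_assoc,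
      hM.1]
  have hadd : ∀ (f g : V) (e : M), e * E f.support = e → e * E g.support = e →
      e * E (f + g).support = e := by
    intro f g e h1 h3
    apply Egl
    intro s hs
    rcases hsub f g s hs with h | h
    · rw [← h1, mul_assoc, Ele _ _ h]
    · rw [← h3, mul_assoc, Ele _ _ h]
  let pick : ∀ f : V, deg f = 1 → S := fun f hf => (hne f hf).choose
  have hpick : ∀ f hf, pick f hf ∈ f.support := fun f hf => (hne f hf).choose_spec
  have hdeg : ∀ (f : V), deg f = (if (f, true).2 = true then (1 : ZMod p) else 0) → deg f = 1 := by
    intro f h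
    rwa [if_pos rfl] at h
  let H := Cov deg (1 : ZMod p)
  let ψ : H → M := fun x => if h : x.1.2 = true then
    E x.1.1.support * (pick x.1.1 (by have := x.2; rwa [if_pos h] at this)).1 else E x.1.1.support
  have ψodd : ∀ (f : V) (h) (s : S), s ∈ f.support →
      ψ ⟨(f, true), h⟩ = E f.support * s.1 := by
    intro f h s hs
    have : ψ ⟨(f, true), h⟩ = E f.support * (pick f (hdeg f h)).1 := dif_pos rfl
    rw [this]
    exact hsame _ _ _ (Ele _ _ (hpick f (hdeg f h))) (Ele _ _ hs)
  have ψeven : ∀ (f : V) (h), ψ ⟨(f, false), h⟩ = E f.support := by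
    intro f h
    simp [ψ]
  have hle : ∀ (e : M) (f : V) (s t : S), e * e = e → e * (s.1 * inv s.1) = e →
      e * E f.support = e → t ∈ f.support → natLe (e * s.1) (E f.support * t.1) := by
    intro e f s t he h1 h3 ht
    refine ⟨e, he, ?_⟩
    rw [← mul_assoc, h3]
    apply hsame _ _ _ h1
    rw [← h3, mul_assoc, Ele _ _ ht]
  have hEneg : ∀ f : V, E (-f).support = E f.support := fun f => by rw [Finsupp.support_neg]
  have hdabs : ∀ e f x : M, f * f = f → x * x = x → e * f = e → (e * x) * f = e * x := by
    intro e f x hf hx h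
    rw [mul_assoc, idem_comm hM hx hf, ← mul_assoc, h]
  refine ⟨H, covGroup deg 1 τ hτ hd, ψ, ⟨?_, ?_, ?_⟩, ?_, ?_, ?_⟩
  · change ψ (covOne deg 1) = 1
    rw [covOne, ψeven]
    have := Egl (0 : V).support 1 (by simp)
    rwa [one_mul] at this
  · rintro ⟨⟨f, b⟩, hx⟩
    change ψ (covInv deg 1 τ hd _) = _
    cases b
    · have : covInv deg 1 τ hd ⟨(f, false), hx⟩ = ⟨(-f, false), by simpa using hx⟩ := by
        apply Subtype.ext; simp [covInv]
      rw [this, ψeven, ψeven, hEneg, idem_inv hM (Eid _)]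
    · have hf := hdeg f hx
      have : covInv deg 1 τ hd ⟨(f, true), hx⟩ = ⟨(-τ f, true), by simpa [hd] using hf⟩ := by
        apply Subtype.ext; simp [covInv]
      obtain ⟨s, hs⟩ := hne f hf
      have hs' : θ s ∈ (-τ f).support := by
        rw [Finsupp.support_neg, hsupp, hθ s]; exact hs
      rw [this, ψodd _ _ s hs, ψodd _ _ _ hs', inv_mul' hM, idem_inv hM (Eid _), hEneg]
      -- E(τ f) s⁻¹ = s⁻¹ E f
      change E (τ f).support * inv s.1 = _
      have A := hconj f (θ s)
      have B := hconj (τ f) s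
      rw [hτ] at B
      simp only [θ, inv_inv' hM] at A
      have C : E (τ f).support * (inv s.1 * s.1) = E (τ f).support := by
        have := Ele (τ f).support (θ s) (by rw [hsupp, hθ s]; exact hs)
        simpa only [θ, inv_inv' hM] using this
      have ci := conj_idem hM (inv s.1) (Eid f.support)
      rw [inv_inv' hM] at ci
      have D : E (τ f).support = inv s.1 * E f.support * s.1 := by
        have C' : (inv s.1 * s.1) * E (τ f).support = E (τ f).support := by
          rw [idem_comm hM (r_idem hM _) (Eid _), C]
        calc E (τ f).support = (inv s.1 * s.1) * E (τ f).support * (inv s.1 * s.1) := by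
              rw [C', C]
          _ = inv s.1 * (s.1 * E (τ f).support * inv s.1) * s.1 := by simp only [mul_assoc]
          _ = inv s.1 * (s.1 * E (τ f).support * inv s.1 * E f.support) * s.1 := by rw [B]
          _ = ((inv s.1 * s.1) * E (τ f).support) * (inv s.1 * E f.support * s.1) := by
              simp only [mul_assoc]
          _ = E (τ f).support * (inv s.1 * E f.support * s.1) := by rw [C']
          _ = (inv s.1 * E f.support * s.1) * E (τ f).support := idem_comm hM (Eid _) ci
          _ = _ := A
      rw [D]
      have := hswap (inv s.1) (E f.support) (Eid _)
      rw [inv_inv' hM] at this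
      exact this.symm
  · rintro ⟨⟨f, b⟩, hx⟩ ⟨⟨g, c⟩, hy⟩
    change natLe _ (ψ (covMul deg 1 τ hd _ _))
    have hfg : E f.support * E g.support * E g.support = E f.support * E g.support := by
      rw [mul_assoc, Eid]
    have hfg' : E f.support * E g.support * E f.support = E f.support * E g.support :=
      hdabs _ _ _ (Eid _) (Eid _) (Eid _)
    have hfgi := idem_mul hM (Eid f.support) (Eid g.support)
    have hm := (covMul deg 1 τ hd ⟨(f, b), hx⟩ ⟨(g, c), hy⟩).2
    cases b <;> cases c
    · replace hm : deg (f + g, false).1 = if (f + g, false).2 = true then 1 else 0 := hm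
      change natLe _ (ψ ⟨(f + g, false), hm⟩)
      rw [ψeven, ψeven, ψeven]
      exact ⟨_, hfgi, (hadd f g _ hfg' hfg).symm⟩
    · replace hm : deg (f + g, true).1 = if (f + g, true).2 = true then 1 else 0 := hm
      change natLe _ (ψ ⟨(f + g, true), hm⟩)
      obtain ⟨s, hs⟩ := hne g (hdeg _ hy)
      obtain ⟨t, ht⟩ := hne (f + g) (hdeg _ hm)
      rw [ψeven, ψodd _ _ s hs, ψodd _ _ t ht, ← mul_assoc]
      refine hle _ _ _ _ hfgi ?_ (hadd f g _ hfg' hfg) ht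
      rw [mul_assoc, Ele _ _ hs]
    · replace hm : deg (f + τ g, true).1 = if (f + τ g, true).2 = true then 1 else 0 := hm
      change natLe _ (ψ ⟨(f + τ g, true), hm⟩)
      obtain ⟨s, hs⟩ := hne f (hdeg _ hx)
      obtain ⟨t, ht⟩ := hne (f + τ g) (hdeg _ hm)
      rw [ψeven, ψodd _ _ s hs, ψodd _ _ t ht, mul_assoc, hswap _ _ (Eid g.support), ← mul_assoc]
      have ci := conj_idem hM s.1 (Eid g.support)
      refine hle _ _ _ _ (idem_mul hM (Eid _) ci) ?_ (hadd f (τ g) _ ?_ ?_) ht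
      · exact hdabs _ _ _ (d_idem hM _) ci (Ele _ _ hs)
      · exact hdabs _ _ _ (Eid _) ci (Eid _)
      · rw [mul_assoc, hconj]
    · replace hm : deg (f + τ g, false).1 = if (f + τ g, false).2 = true then 1 else 0 := hm
      change natLe _ (ψ ⟨(f + τ g, false), hm⟩)
      obtain ⟨s, hs⟩ := hne f (hdeg _ hx)
      obtain ⟨u, hu⟩ := hne g (hdeg _ hy)
      have ci := conj_idem hM s.1 (Eid g.support)
      have hsu := prod_idem hM hEU h2 s.2 u.2
      have e1 : E f.support * s.1 * (E g.support * u.1)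
          = E f.support * (s.1 * E g.support * inv s.1) * (s.1 * u.1) := by
        calc E f.support * s.1 * (E g.support * u.1)
            = E f.support * (s.1 * E g.support) * u.1 := by simp only [mul_assoc]
          _ = _ := by
            conv_lhs => rw [hswap _ _ (Eid g.support)]
            simp only [mul_assoc]
      rw [ψodd _ _ s hs, ψodd _ _ u hu, ψeven, e1]
      have c2 := idem_mul hM (Eid f.support) ci
      refine ⟨_, idem_mul hM c2 hsu, (hadd f (τ g) _ ?_ ?_).symm⟩
      · exact hdabs _ _ _ (Eid _) hsu (hdabs _ _ _ (Eid _) ci (Eid _))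
      · exact hdabs _ _ _ (Eid _) hsu (by rw [mul_assoc, hconj])
  · intro m
    by_cases hm : m * m = m
    · refine ⟨covOne deg 1, m, hm, ?_⟩
      rw [covOne, ψeven]
      exact (Egl _ m (by simp)).symm
    · have : Fact p.Prime := ⟨hp⟩
      let s : S := ⟨m, hm⟩
      have hsup : (Finsupp.single s (1 : ZMod p)).support = {s} :=
        Finsupp.support_single_ne_zero _ one_ne_zero
      have hds : deg (Finsupp.single s 1) = 1 := by
        change (Finsupp.single s (1 : ZMod p)).sum (fun _ x => x) = 1
        rw [Finsupp.sum_single_index rfl]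
      refine ⟨⟨(Finsupp.single s 1, true), hds⟩, m * inv m, d_idem hM m, ?_⟩
      rw [ψodd _ _ s (by rw [hsup]; simp), ← mul_assoc, Egl, hM.1]
      intro t ht
      rw [hsup, Finset.mem_singleton] at ht
      subst ht
      exact d_idem hM m
  all_goals
    have hker : ∀ n : H, ψ n * ψ n = ψ n → n.1.2 = false := by
      rintro ⟨⟨f, b⟩, hx⟩ hn
      cases b
      · rfl
      · exfalso
        obtain ⟨s, hs⟩ := hne f (hdeg _ hx)
        rw [ψodd _ _ s hs] at hn
        exact s.2 (hEU _ _ hn ⟨_, Eid _, rfl⟩)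
  · letI := covGroup deg 1 τ hτ hd
    intro n hn
    have hb := hker n hn
    have hpow : ∀ k : ℕ, (n ^ k).1 = (k • n.1.1, false) := by
      intro k
      induction k with
      | zero => rw [pow_zero, zero_smul]; rfl
      | succ k ih =>
        rw [pow_succ]
        change (covMul deg 1 τ hd _ _).1 = _
        simp only [covMul, ih, hb, succ_nsmul]
        simp
    apply Subtype.ext
    rw [hpow p]
    change _ = ((0 : V), false)
    congr 1
    have hz : ∀ f : S →₀ ZMod p, p • f = 0 := by
      intro f
      ext s
      simp
    exact hz _
  · intro n k hn hk
    have hb := hker n hn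
    have hc := hker k hk
    change covMul deg 1 τ hd _ _ = covMul deg 1 τ hd _ _
    apply Subtype.ext
    simp [covMul, hb, hc, add_comm]
end
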